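/- Fix β₂ > 0, β₁ ∈ ℝ with |β₁| ≤ β₂ and β₁ < 1, and η > 0. For every fixed μ > 0, the efficiency functional satisfies Eff(μ, σ²) → 0 as σ² → 0⁺ and Eff(μ, σ²) → 0 as σ² → ∞. -/

import Mathlib

open MeasureTheory ProbabilityTheory Real Filter Set
open scoped Topology

/-- The Metropolis–Hastings accept-reject function `F(u) = min(1, eᵘ)`. -/
noncomputable def Facc (u : ℝ) : ℝ := min 1 (Real.exp u)

/-- The law of the limiting bivariate Gaussian pair `(Q∞, S∞)` with
`Q∞ ~ N(−μ²/2, μ²)`, `S∞ ~ N(β₁μ²/2, β₂²μ²)` and `Cov(Q∞, S∞) = −β₁μ²`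
(valid whenever `|β₁| ≤ β₂`), realised as the image of two independent
standard Gaussians. -/
noncomputable def QSmeas (μ β₁ β₂ : ℝ) : Measure (ℝ × ℝ) :=
  Measure.map
    (fun z : ℝ × ℝ =>
      (-μ ^ 2 / 2 + μ * z.1,
        β₁ * μ ^ 2 / 2 + μ * (-(β₁ * z.1) + Real.sqrt (β₂ ^ 2 - β₁ ^ 2) * z.2)))
    ((gaussianReal 0 1).prod (gaussianReal 0 1))

/-- Law of `W_Δ = W* − W ~ N(−σ², 2σ²)` under the Gaussian noise assumption. -/
noncomputable def gaussNoise (σ : ℝ) : Measure ℝ :=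
  gaussianReal (-σ ^ 2) (Real.toNNReal (2 * σ ^ 2))

/-- Limiting Stage One acceptance rate `α₁(μ; β₁, β₂) = E[F(Q∞ + S∞)]`. -/
noncomputable def alpha1 (μ β₁ β₂ : ℝ) : ℝ :=
  ∫ p : ℝ × ℝ, Facc (p.1 + p.2) ∂(QSmeas μ β₁ β₂)

/-- Limiting overall acceptance rate `α₁₂(μ, σ; β₁, β₂) = E[F(Q∞ + S∞)·F(W_Δ − S∞)]`. -/
noncomputable def alpha12 (μ σ β₁ β₂ : ℝ) : ℝ :=
  ∫ p : (ℝ × ℝ) × ℝ, Facc (p.1.1 + p.1.2) * Facc (p.2 - p.1.2)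
    ∂((QSmeas μ β₁ β₂).prod (gaussNoise σ))

/-- Standard normal cumulative distribution function `Φ`. -/
noncomputable def stdPhi (x : ℝ) : ℝ := ((gaussianReal 0 1) (Set.Iic x)).toReal

/-- The efficiency functional `Eff(μ, σ²) = μ² σ² α₁₂(μ, σ) / (η σ² + α₁(μ))`,
written as a function of `v = σ²`. -/
noncomputable def Eff (η μ β₁ β₂ v : ℝ) : ℝ :=
  μ ^ 2 * v * alpha12 μ (Real.sqrt v) β₁ β₂ / (η * v + alpha1 μ β₁ β₂)

theorem Facc_pos (u : ℝ) : 0 < Facc u := lt_min one_pos (Real.exp_pos u)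

theorem Facc_le_one (u : ℝ) : Facc u ≤ 1 := min_le_left _ _

theorem continuous_Facc : Continuous Facc := continuous_const.min Real.continuous_exp

theorem tendsto_Facc_atBot : Tendsto Facc atBot (𝓝 0) :=
  squeeze_zero (fun u => (Facc_pos u).le) (fun _ => min_le_right _ _) Real.tendsto_exp_atBot

theorem Facc_mul_Facc_le_one (u w : ℝ) : Facc u * Facc w ≤ 1 :=
  mul_le_one₀ (Facc_le_one u) (Facc_pos w).le (Facc_le_one w)

instance isProbabilityMeasure_QSmeas (μ β₁ β₂ : ℝ) : IsProbabilityMeasure (QSmeas μ β₁ β₂) :=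
  Measure.isProbabilityMeasure_map (by fun_prop)

instance isProbabilityMeasure_gaussNoise (σ : ℝ) : IsProbabilityMeasure (gaussNoise σ) := by
  unfold gaussNoise; infer_instance

theorem alpha1_pos (μ β₁ β₂ : ℝ) : 0 < alpha1 μ β₁ β₂ := by
  have hcont : Continuous fun p : ℝ × ℝ => Facc (p.1 + p.2) :=
    continuous_Facc.comp (by fun_prop)
  have hint : Integrable (fun p : ℝ × ℝ => Facc (p.1 + p.2)) (QSmeas μ β₁ β₂) :=
    Integrable.of_bound hcont.aestronglyMeasurable 1 <| ae_of_all _ fun p => by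
      rw [Real.norm_of_nonneg (Facc_pos _).le]; exact Facc_le_one _
  have hsupp : Function.support (fun p : ℝ × ℝ => Facc (p.1 + p.2)) = univ :=
    eq_univ_of_forall fun p => (Facc_pos _).ne'
  unfold alpha1
  rw [integral_pos_iff_support_of_nonneg (fun p => (Facc_pos _).le) hint, hsupp, measure_univ]
  exact one_pos

theorem alpha12_nonneg (μ σ β₁ β₂ : ℝ) : 0 ≤ alpha12 μ σ β₁ β₂ :=
  integral_nonneg fun _ => mul_nonneg (Facc_pos _).le (Facc_pos _).le

theorem alpha12_le_one (μ σ β₁ β₂ : ℝ) : alpha12 μ σ β₁ β₂ ≤ 1 := by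
  have h := integral_mono_of_nonneg
    (μ := (QSmeas μ β₁ β₂).prod (gaussNoise σ))
    (f := fun p : (ℝ × ℝ) × ℝ => Facc (p.1.1 + p.1.2) * Facc (p.2 - p.1.2)) (g := fun _ => 1)
    (ae_of_all _ fun _ => mul_nonneg (Facc_pos _).le (Facc_pos _).le) (integrable_const _)
    (ae_of_all _ fun _ => Facc_mul_Facc_le_one _ _)
  simpa [alpha12] using h

theorem gaussNoise_eq_map (σ : ℝ) :
    gaussNoise σ = (gaussianReal 0 1).map fun z => -σ ^ 2 + √2 * σ * z := by
  have h : (fun z : ℝ => -σ ^ 2 + √2 * σ * z) = (fun z => -σ ^ 2 + z) ∘ fun z => √2 * σ * z := rfl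
  rw [h, ← Measure.map_map (by fun_prop) (by fun_prop), gaussianReal_map_const_mul,
    gaussianReal_map_const_add, gaussNoise]
  congr 1
  · ring
  · ext
    rw [Real.coe_toNNReal _ (by positivity)]
    simp [mul_pow]

theorem alpha12_eq_integral_std (μ σ β₁ β₂ : ℝ) :
    alpha12 μ σ β₁ β₂ = ∫ p : (ℝ × ℝ) × ℝ,
      Facc (p.1.1 + p.1.2) * Facc (-σ ^ 2 + √2 * σ * p.2 - p.1.2)
        ∂((QSmeas μ β₁ β₂).prod (gaussianReal 0 1)) := by
  have h := Measure.map_prod_map (QSmeas μ β₁ β₂) (gaussianReal 0 1) (f := id)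
    (g := fun z => -σ ^ 2 + √2 * σ * z) measurable_id (by fun_prop)
  rw [Measure.map_id, ← gaussNoise_eq_map] at h
  have hcont : Continuous fun p : (ℝ × ℝ) × ℝ => Facc (p.1.1 + p.1.2) * Facc (p.2 - p.1.2) :=
    (continuous_Facc.comp (by fun_prop)).mul (continuous_Facc.comp (by fun_prop))
  rw [alpha12, h, integral_map (by fun_prop) hcont.aestronglyMeasurable]
  rfl

theorem tendsto_alpha12_atTop (μ β₁ β₂ : ℝ) :
    Tendsto (fun σ => alpha12 μ σ β₁ β₂) atTop (𝓝 0) := by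
  simp_rw [alpha12_eq_integral_std]
  suffices h : Tendsto (fun σ : ℝ => ∫ p : (ℝ × ℝ) × ℝ,
      Facc (p.1.1 + p.1.2) * Facc (-σ ^ 2 + √2 * σ * p.2 - p.1.2)
        ∂((QSmeas μ β₁ β₂).prod (gaussianReal 0 1))) atTop
      (𝓝 (∫ _, 0 ∂((QSmeas μ β₁ β₂).prod (gaussianReal 0 1)))) by
    simpa only [integral_zero] using h
  refine tendsto_integral_filter_of_dominated_convergence (fun _ => 1) ?_ ?_
    (integrable_const _) ?_
  · refine Eventually.of_forall fun σ => Continuous.aestronglyMeasurable ?_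
    exact (continuous_Facc.comp (by fun_prop)).mul (continuous_Facc.comp (by fun_prop))
  · refine Eventually.of_forall fun σ => ae_of_all _ fun p => ?_
    rw [Real.norm_of_nonneg (mul_nonneg (Facc_pos _).le (Facc_pos _).le)]
    exact Facc_mul_Facc_le_one _ _
  · refine ae_of_all _ fun p => ?_
    have h1 : Tendsto (fun σ : ℝ => √2 * p.2 - σ) atTop atBot :=
      tendsto_atBot_add_const_left _ _ tendsto_neg_atTop_atBot
    have h2 : Tendsto (fun σ : ℝ => -σ ^ 2 + √2 * σ * p.2 - p.1.2) atTop atBot := by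
      refine (tendsto_atBot_add_const_right _ (-p.1.2) (tendsto_id.atTop_mul_atBot₀ h1)).congr
        fun σ => ?_
      simp only [id]
      ring
    simpa using (tendsto_Facc_atBot.comp h2).const_mul (Facc (p.1.1 + p.1.2))

/-- for fixed `β₂ > 0`, `|β₁| ≤ β₂`, `β₁ < 1`, `η > 0` and every fixed
`μ > 0`, the efficiency `Eff(μ, σ²) → 0` both as `σ² → 0⁺` and as `σ² → ∞`. -/
theorem stmt14 (β₁ β₂ η : ℝ) (hβ₂ : 0 < β₂) (hβ : |β₁| ≤ β₂) (hβ₁ : β₁ < 1) (hη : 0 < η)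
    (μ : ℝ) (hμ : 0 < μ) :
    Tendsto (fun v : ℝ => Eff η μ β₁ β₂ v) (nhdsWithin 0 (Set.Ioi 0)) (nhds 0) ∧
      Tendsto (fun v : ℝ => Eff η μ β₁ β₂ v) atTop (nhds 0) := by
  have hα := alpha1_pos μ β₁ β₂
  have hnonneg {v : ℝ} (hv : 0 < v) : 0 ≤ Eff η μ β₁ β₂ v :=
    div_nonneg (mul_nonneg (by positivity) (alpha12_nonneg ..)) (by positivity)
  constructor
  · have hlim : Tendsto (fun v : ℝ => μ ^ 2 * v / alpha1 μ β₁ β₂) (𝓝[>] 0) (𝓝 0) := by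
      have hcont : Continuous fun v : ℝ => μ ^ 2 * v / alpha1 μ β₁ β₂ := by fun_prop
      simpa using (hcont.tendsto 0).mono_left nhdsWithin_le_nhds
    refine squeeze_zero' ?_ ?_ hlim
    · filter_upwards [self_mem_nhdsWithin] with v hv using hnonneg hv
    · filter_upwards [self_mem_nhdsWithin] with v hv
      have hv : 0 < v := hv
      refine div_le_div₀ (by positivity) ?_ hα (le_add_of_nonneg_left (by positivity))
      exact mul_le_of_le_one_right (by positivity) (alpha12_le_one ..)
  · have hlim : Tendsto (fun v : ℝ => μ ^ 2 / η * alpha12 μ (√v) β₁ β₂) atTop (𝓝 0) := by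
      simpa using ((tendsto_alpha12_atTop μ β₁ β₂).comp tendsto_sqrt_atTop).const_mul (μ ^ 2 / η)
    refine squeeze_zero' ?_ ?_ hlim
    · filter_upwards [eventually_gt_atTop 0] with v hv using hnonneg hv
    · filter_upwards [eventually_gt_atTop 0] with v hv
      have h0 := alpha12_nonneg μ (√v) β₁ β₂
      calc Eff η μ β₁ β₂ v ≤ μ ^ 2 * v * alpha12 μ (√v) β₁ β₂ / (η * v) :=
            div_le_div_of_nonneg_left (by positivity) (by positivity)
              (le_add_of_nonneg_right hα.le)
        _ = μ ^ 2 / η * alpha12 μ (√v) β₁ β₂ := by field_simp
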